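/- For every integer q with q ≥ 2, there exist no integers a₁, a₂, a₃, b₁, b₂, b₃, c₁, c₂, c₃ satisfying simultaneously: (i) |a₁a₂c₃ + a₁c₂a₃ + c₁a₂a₃ + 2q²c₁c₂c₃ + b₁b₂c₃ + b₁c₂b₃ + c₁b₂b₃| = 8; (ii) Σᵢ₌₁³ (aᵢ² + bᵢ² + 2q²cᵢ²) = 6 + 8q²; (iii) a₁c₁ + a₂c₂ + a₃c₃ = 0; and (iv) b₁c₁ + b₂c₂ + b₃c₃ = 0. -/

import Mathlib

/-- `6 q² + 22` is never a sum of two squares, by reduction modulo `16`. -/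
lemma sq_add_sq_ne_six_mul_sq_add (q x y : ℤ) : x ^ 2 + y ^ 2 ≠ 6 * q ^ 2 + 22 := by
  intro h
  have sq_zmod : ∀ z : ZMod 16, z ^ 2 = 0 ∨ z ^ 2 = 1 ∨ z ^ 2 = 4 ∨ z ^ 2 = 9 := by decide
  have h' : (x : ZMod 16) ^ 2 + (y : ZMod 16) ^ 2 = 6 * (q : ZMod 16) ^ 2 + 22 := by
    exact_mod_cast congrArg (Int.cast : ℤ → ZMod 16) h
  rcases sq_zmod x with hx | hx | hx | hx <;> rcases sq_zmod y with hy | hy | hy | hy <;>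
    rcases sq_zmod q with hz | hz | hz | hz <;> rw [hx, hy, hz] at h' <;>
    exact absurd h' (by decide)

/-- The case where only one of the `cᵢ` is nonzero. -/
lemma abs_mul_ne_eight_of_sum_sq {q c x y z w : ℤ} (hc : c ≠ 0) (hc4 : c ^ 2 ≤ 4)
    (hsum : x ^ 2 + y ^ 2 + z ^ 2 + w ^ 2 + 2 * q ^ 2 * c ^ 2 = 6 + 8 * q ^ 2) :
    |c * (x * y + z * w)| ≠ 8 := by
  intro h
  have hle : |c| ≤ 2 := abs_le_of_sq_le_sq (by linarith) (by norm_num)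
  have hpos : 0 < |c| := abs_pos.mpr hc
  rw [abs_mul] at h
  rw [← sq_abs c] at hsum
  obtain hc1 | hc2 : |c| = 1 ∨ |c| = 2 := by omega
  · rw [hc1] at h hsum
    rcases eq_or_eq_neg_of_abs_eq (one_mul |x * y + z * w| ▸ h) with h | h
    · exact sq_add_sq_ne_six_mul_sq_add q (x + y) (z + w) (by linear_combination hsum + 2 * h)
    · exact sq_add_sq_ne_six_mul_sq_add q (x - y) (z - w) (by linear_combination hsum - 2 * h)
  · rw [hc2] at h hsum
    rcases eq_or_eq_neg_of_abs_eq (show |x * y + z * w| = 4 by omega) with h | h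
    · nlinarith [sq_nonneg (x - y), sq_nonneg (z - w)]
    · nlinarith [sq_nonneg (x + y), sq_nonneg (z + w)]

lemma sq_eq_one_of_sq_lt_four {c : ℤ} (hc : c ≠ 0) (h : c ^ 2 < 4) : c ^ 2 = 1 := by
  have hlt : |c| < 2 := abs_lt_of_sq_lt_sq (by linarith) (by norm_num)
  have hpos : 0 < |c| := abs_pos.mpr hc
  rw [← sq_abs, show |c| = 1 by omega, one_pow]

/-- The case where some `cᵢ` vanishes. -/
lemma abs_euler_ne_eight_of_eq_zero {q a₁ a₂ a₃ b₁ b₂ b₃ c₂ c₃ : ℤ}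
    (hc : c₂ ^ 2 + c₃ ^ 2 ≤ 4)
    (hsum : a₁ ^ 2 + a₂ ^ 2 + a₃ ^ 2 + b₁ ^ 2 + b₂ ^ 2 + b₃ ^ 2 + 2 * q ^ 2 * (c₂ ^ 2 + c₃ ^ 2)
      = 6 + 8 * q ^ 2)
    (ha : a₂ * c₂ + a₃ * c₃ = 0) (hb : b₂ * c₂ + b₃ * c₃ = 0) :
    |c₃ * (a₁ * a₂ + b₁ * b₂) + c₂ * (a₁ * a₃ + b₁ * b₃)| ≠ 8 := by
  intro h
  by_cases h2 : c₂ = 0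
  · subst h2
    by_cases h3 : c₃ = 0
    · simp [h3] at h
    · have ha3 : a₃ = 0 := by simpa [h3] using ha
      have hb3 : b₃ = 0 := by simpa [h3] using hb
      subst ha3 hb3
      exact abs_mul_ne_eight_of_sum_sq (q := q) (x := a₁) (y := a₂) (z := b₁) (w := b₂) h3
        (by linarith) (by linarith) (by simpa using h)
  by_cases h3 : c₃ = 0
  · subst h3
    have ha2 : a₂ = 0 := by simpa [h2] using ha
    have hb2 : b₂ = 0 := by simpa [h2] using hb
    subst ha2 hb2
    exact abs_mul_ne_eight_of_sum_sq (q := q) (x := a₁) (y := a₃) (z := b₁) (w := b₃) h2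
      (by linarith) (by linarith) (by simpa using h)
  have hs2 := sq_eq_one_of_sq_lt_four h2 (by have := sq_pos_of_ne_zero h3; linarith)
  have hs3 := sq_eq_one_of_sq_lt_four h3 (by have := sq_pos_of_ne_zero h2; linarith)
  have hzero : c₃ * (a₁ * a₂ + b₁ * b₂) + c₂ * (a₁ * a₃ + b₁ * b₃) = 0 := by
    linear_combination c₂ * c₃ * (a₁ * ha + b₁ * hb) -
      c₃ * (a₁ * a₂ + b₁ * b₂) * hs2 - c₂ * (a₁ * a₃ + b₁ * b₃) * hs3
  simp [hzero] at h


/-- For every integer `q ≥ 2`, there exist no integers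
`a₁, a₂, a₃, b₁, b₂, b₃, c₁, c₂, c₃` satisfying simultaneously:
(i) `|a₁a₂c₃ + a₁c₂a₃ + c₁a₂a₃ + 2q²c₁c₂c₃ + b₁b₂c₃ + b₁c₂b₃ + c₁b₂b₃| = 8`;
(ii) `Σᵢ(aᵢ² + bᵢ² + 2q²cᵢ²) = 6 + 8q²`;
(iii) `a₁c₁ + a₂c₂ + a₃c₃ = 0`; and (iv) `b₁c₁ + b₂c₂ + b₃c₃ = 0`. -/
theorem stmt6 (q : ℤ) (hq : 2 ≤ q) :
    ¬ ∃ a₁ a₂ a₃ b₁ b₂ b₃ c₁ c₂ c₃ : ℤ,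
      |a₁ * a₂ * c₃ + a₁ * c₂ * a₃ + c₁ * a₂ * a₃ + 2 * q ^ 2 * c₁ * c₂ * c₃
        + b₁ * b₂ * c₃ + b₁ * c₂ * b₃ + c₁ * b₂ * b₃| = 8 ∧
      (a₁ ^ 2 + b₁ ^ 2 + 2 * q ^ 2 * c₁ ^ 2) + (a₂ ^ 2 + b₂ ^ 2 + 2 * q ^ 2 * c₂ ^ 2)
        + (a₃ ^ 2 + b₃ ^ 2 + 2 * q ^ 2 * c₃ ^ 2) = 6 + 8 * q ^ 2 ∧
      a₁ * c₁ + a₂ * c₂ + a₃ * c₃ = 0 ∧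
      b₁ * c₁ + b₂ * c₂ + b₃ * c₃ = 0 := by
  rintro ⟨a₁, a₂, a₃, b₁, b₂, b₃, c₁, c₂, c₃, he, hsum, ha, hb⟩
  have hN : c₁ ^ 2 + c₂ ^ 2 + c₃ ^ 2 ≤ 4 := by
    by_contra! hlt
    have hq2 : 4 ≤ q ^ 2 := by nlinarith
    nlinarith [sq_nonneg a₁, sq_nonneg a₂, sq_nonneg a₃, sq_nonneg b₁, sq_nonneg b₂,
      sq_nonneg b₃, mul_nonneg (sq_nonneg q) (sub_nonneg.mpr (Int.add_one_le_iff.mpr hlt))]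
  by_cases h1 : c₁ = 0
  · subst h1
    refine abs_euler_ne_eight_of_eq_zero (q := q) (a₁ := a₁) (b₁ := b₁) (c₂ := c₂) (c₃ := c₃)
      (a₂ := a₂) (a₃ := a₃) (b₂ := b₂) (b₃ := b₃)
      (by linarith) (by linarith) (by linarith) (by linarith) ?_
    rw [← he]; congr 1; ring
  by_cases h2 : c₂ = 0
  · subst h2
    refine abs_euler_ne_eight_of_eq_zero (q := q) (a₁ := a₂) (b₁ := b₂) (c₂ := c₁) (c₃ := c₃)
      (a₂ := a₁) (a₃ := a₃) (b₂ := b₁) (b₃ := b₃)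
      (by linarith) (by linarith) (by linarith) (by linarith) ?_
    rw [← he]; congr 1; ring
  by_cases h3 : c₃ = 0
  · subst h3
    refine abs_euler_ne_eight_of_eq_zero (q := q) (a₁ := a₃) (b₁ := b₃) (c₂ := c₁) (c₃ := c₂)
      (a₂ := a₁) (a₃ := a₂) (b₂ := b₁) (b₃ := b₂)
      (by linarith) (by linarith) (by linarith) (by linarith) ?_
    rw [← he]; congr 1; ring
  have p1 := sq_pos_of_ne_zero h1
  have p2 := sq_pos_of_ne_zero h2
  have p3 := sq_pos_of_ne_zero h3
  have s1 := sq_eq_one_of_sq_lt_four h1 (by linarith)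
  have s2 := sq_eq_one_of_sq_lt_four h2 (by linarith)
  have s3 := sq_eq_one_of_sq_lt_four h3 (by linarith)
  set e := a₁ * a₂ * c₃ + a₁ * c₂ * a₃ + c₁ * a₂ * a₃ + 2 * q ^ 2 * c₁ * c₂ * c₃
    + b₁ * b₂ * c₃ + b₁ * c₂ * b₃ + c₁ * b₂ * b₃ with e_def
  have he2 : e ^ 2 = 64 := by rw [← sq_abs, he]; norm_num
  have hP : (c₁ * c₂ * c₃) ^ 2 = 1 := by rw [mul_pow, mul_pow, s1, s2, s3]; norm_num
  have hPe : c₁ * c₂ * c₃ * e = q ^ 2 - 3 := by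
    have hexp : c₁ * c₂ * c₃ * e = c₁ * c₂ * (a₁ * a₂ + b₁ * b₂) + c₁ * c₃ * (a₁ * a₃ + b₁ * b₃)
        + c₂ * c₃ * (a₂ * a₃ + b₂ * b₃) + 2 * q ^ 2 := by
      rw [e_def]
      linear_combination c₁ * c₂ * (a₁ * a₂ + b₁ * b₂) * s3 + c₁ * c₃ * (a₁ * a₃ + b₁ * b₃) * s2
        + c₂ * c₃ * (a₂ * a₃ + b₂ * b₃) * s1 + 2 * q ^ 2 * hP
    rw [s1, s2, s3] at hsum
    have hA : (a₁ * c₁ + a₂ * c₂ + a₃ * c₃) ^ 2 + (b₁ * c₁ + b₂ * c₂ + b₃ * c₃) ^ 2 = 0 := by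
      rw [ha, hb]; norm_num
    have hdouble : 2 * (c₁ * c₂ * c₃ * e) = 2 * (q ^ 2 - 3) := by
      linear_combination 2 * hexp + hA - hsum - (a₁ ^ 2 + b₁ ^ 2) * s1 - (a₂ ^ 2 + b₂ ^ 2) * s2
        - (a₃ ^ 2 + b₃ ^ 2) * s3
    linarith
  have hq64 : (q ^ 2 - 3) ^ 2 = 64 := by rw [← hPe, mul_pow, hP, he2]; norm_num
  obtain hq3 | hq4 : q ≤ 3 ∨ 4 ≤ q := by omega
  · interval_cases q <;> norm_num at hq64
  · have hq16 : 13 ≤ q ^ 2 - 3 := by nlinarith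
    nlinarith
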